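/- Every t-monotone permutation has width at most 6t−5. -/

import Mathlib

/-- A point in the plane. -/
abbrev Pt := ℕ × ℕ
/-- A (discrete) interval, given by its two endpoints. -/
abbrev Iv := ℕ × ℕ
/-- An axis-parallel rectangle: a pair (x-interval, y-interval). -/
abbrev Rect := Iv × Iv

/-- The α-coordinate of a point (α ∈ {1,2} encoded as Fin 2). -/
def coordPt (α : Fin 2) (p : Pt) : ℕ := if α = 0 then p.1 else p.2

/-- The α-projection of a rectangle. -/
def rproj (α : Fin 2) (R : Rect) : Iv := if α = 0 then R.1 else R.2

/-- Two intervals intersect. -/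
def ivOverlap (I J : Iv) : Prop := I.1 ≤ J.2 ∧ J.1 ≤ I.2

instance : ∀ I J, Decidable (ivOverlap I J) := fun I J => by
  unfold ivOverlap; infer_instance

/-- Interval `I` lies strictly before interval `J`. -/
def ivLt (I J : Iv) : Prop := I.2 < J.1

instance : ∀ I J, Decidable (ivLt I J) := fun I J => by
  unfold ivLt; infer_instance

/-- Interval containment. -/
def ivSub (I J : Iv) : Prop := J.1 ≤ I.1 ∧ I.2 ≤ J.2

instance : ∀ I J, Decidable (ivSub I J) := fun I J => by
  unfold ivSub; infer_instance

/-- Two rectangles α-view each other: their α-projections intersect. -/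
def rviews (α : Fin 2) (R R' : Rect) : Prop := ivOverlap (rproj α R) (rproj α R')

instance : ∀ α R R', Decidable (rviews α R R') := fun α R R' => by
  unfold rviews; infer_instance

/-- The degenerate rectangle corresponding to a point. -/
def ptRect (p : Pt) : Rect := ((p.1, p.1), (p.2, p.2))

/-- The bounding box of two rectangles. -/
def bbox (R1 R2 : Rect) : Rect :=
  ((min R1.1.1 R2.1.1, max R1.1.2 R2.1.2), (min R1.2.1 R2.2.1, max R1.2.2 R2.2.2))

/-- A rectangle family (as a multiset of rectangles). -/
abbrev Fam := Multiset Rect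

/-- A family is `d`-wide: every rectangle α-views fewer than `d` other rectangles. -/
def Wide (d : ℕ) (F : Fam) : Prop :=
  ∀ R ∈ F, ∀ α : Fin 2,
    Multiset.card (Multiset.filter (fun R' => rviews α R R') (F.erase R)) < d

/-- One merge step: two rectangles of the family are replaced by their bounding box. -/
def MergeStep (F F' : Fam) : Prop :=
  ∃ R1 R2, R1 ∈ F ∧ R2 ∈ F.erase R1 ∧ F' = bbox R1 R2 ::ₘ ((F.erase R1).erase R2)

/-- A point set is in general position: no two points share an x- or y-coordinate. -/
def GenPos (P : Finset Pt) : Prop :=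
  ∀ p ∈ P, ∀ q ∈ P, p ≠ q → p.1 ≠ q.1 ∧ p.2 ≠ q.2

/-- `L` is a decomposition of the point set `P`: it starts with the degenerate
rectangles of `P`, each step is a merge, and it ends with a single rectangle. -/
def IsDecomp (P : Finset Pt) (L : List Fam) : Prop :=
  L.head? = some (Multiset.map ptRect P.val) ∧ List.Chain' MergeStep L ∧
  ∃ F, L.getLast? = some F ∧ Multiset.card F = 1

/-- `P` admits a `d`-wide decomposition. -/
def HasWidthLE (P : Finset Pt) (d : ℕ) : Prop :=
  ∃ L, IsDecomp P L ∧ ∀ F ∈ L, Wide d F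

/-- The width of a permutation: the least `d` such that it has a `d`-wide decomposition. -/
noncomputable def permWidth (P : Finset Pt) : ℕ := sInf {d | HasWidthLE P d}

/-- `σ` is a subpattern of `π`: an injection preserving both coordinate orders. -/
def Subpattern (σ π : Finset Pt) : Prop :=
  ∃ φ : Pt → Pt, Set.InjOn φ ↑σ ∧ (∀ p ∈ σ, φ p ∈ π) ∧
    ∀ p ∈ σ, ∀ q ∈ σ,
      (p.1 < q.1 ↔ (φ p).1 < (φ q).1) ∧ (p.2 < q.2 ↔ (φ p).2 < (φ q).2)

/-- `q` lies strictly between `p` and `p'` in coordinate `α`. -/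
def Between (α : Fin 2) (p p' q : Pt) : Prop :=
  min (coordPt α p) (coordPt α p') < coordPt α q ∧
    coordPt α q < max (coordPt α p) (coordPt α p')

instance : ∀ α p p' q, Decidable (Between α p p' q) := fun _ _ _ _ => by
  unfold Between; infer_instance

/-- `{p,p'}` is a `d`-close pair of the point set `S`: in each coordinate, fewer than
`d` points of `S` lie strictly between them. -/
def ClosePair (d : ℕ) (S : Finset Pt) (p p' : Pt) : Prop :=
  ∀ α : Fin 2, (S.filter (Between α p p')).card < d

/-- `S` has a `d`-close pair. -/
def HasClosePair (d : ℕ) (S : Finset Pt) : Prop :=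
  ∃ p ∈ S, ∃ q ∈ S, p ≠ q ∧ ClosePair d S p q

/-- `P` contains an `s × s`-grid: there are monotone threshold sequences in both
coordinates such that each of the `s²` cells contains a point of `P`. -/
def ContainsGrid (s : ℕ) (P : Finset Pt) : Prop :=
  ∃ a b : Fin (s+1) → ℕ, Monotone a ∧ Monotone b ∧
    ∀ i j : Fin s, ∃ p ∈ P,
      a i.castSucc ≤ p.1 ∧ p.1 < a i.succ ∧ b j.castSucc ≤ p.2 ∧ p.2 < b j.succ

/-- The canonical `r × r`-grid permutation. -/
def canonGrid (r : ℕ) : Finset Pt :=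
  (Finset.Icc 1 r ×ˢ Finset.Icc 1 r).image
    (fun ij => ((ij.2 - 1) * r + (r - ij.1 + 1), (ij.1 - 1) * r + ij.2))

/-- A point set is increasing: the x-order and y-order coincide. -/
def IncreasingPts (S : Set Pt) : Prop := ∀ p ∈ S, ∀ q ∈ S, (p.1 < q.1 ↔ p.2 < q.2)

/-- A point set is decreasing: the x-order and y-order are opposite. -/
def DecreasingPts (S : Set Pt) : Prop := ∀ p ∈ S, ∀ q ∈ S, (p.1 < q.1 ↔ q.2 < p.2)

/-- A point set is monotone: increasing or decreasing. -/
def MonotonePts (S : Set Pt) : Prop := IncreasingPts S ∨ DecreasingPts S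

/-- `P` can be partitioned into at most `t` increasing parts. -/
def TIncreasing (t : ℕ) (P : Finset Pt) : Prop :=
  ∃ f : Pt → ℕ, (∀ p ∈ P, f p < t) ∧ ∀ c, IncreasingPts {p | p ∈ P ∧ f p = c}

/-- `P` can be partitioned into at most `t` monotone parts. -/
def TMonotone (t : ℕ) (P : Finset Pt) : Prop :=
  ∃ f : Pt → ℕ, (∀ p ∈ P, f p < t) ∧ ∀ c, MonotonePts {p | p ∈ P ∧ f p = c}

/-- Valid rectangles. -/
def RValid (R : Rect) : Prop := ∀ α, (rproj α R).1 ≤ (rproj α R).2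

/-- list of rectangles is monotone in direction α -/
def MonoL (α : Fin 2) (L : List Rect) : Prop :=
  L.Pairwise (fun R S => ivLt (rproj α R) (rproj α S)) ∨
  L.Pairwise (fun R S => ivLt (rproj α S) (rproj α R))

/-- number of rectangles of the list seen by an interval -/
def vcount (α : Fin 2) (R : Rect) (L : List Rect) : ℕ := L.countP (fun S => decide (rviews α R S))

theorem rproj_bbox (α : Fin 2) (R S : Rect) : rproj α (bbox R S) =
    (min (rproj α R).1 (rproj α S).1, max (rproj α R).2 (rproj α S).2) := by
  unfold rproj bbox; split <;> rfl

theorem rvalid_bbox {R S : Rect} (hR : RValid R) : RValid (bbox R S) := by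
  intro α
  have := hR α
  rw [rproj_bbox]; simp only; omega

theorem gap_inc (L : List Rect) (α : Fin 2)
    (h : L.Pairwise (fun R S => ivLt (rproj α R) (rproj α S))) :
    ∃ K : List ℕ, K.length = L.length - 1 ∧ ∀ R : Rect,
      vcount α R L - 1 ≤ K.countP (fun x => decide ((rproj α R).1 < x ∧ x ≤ (rproj α R).2)) := by
  refine ⟨L.tail.map (fun S => (rproj α S).1), by simp, fun R => ?_⟩
  induction L with
  | nil => simp [vcount]
  | cons A L ih =>
    rw [List.pairwise_cons] at h
    have ih := ih h.2
    simp only [List.tail_cons]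
    by_cases hA : rviews α R A
    · have : vcount α R (A :: L) = vcount α R L + 1 := by simp [vcount, hA]
      rw [this, Nat.add_sub_cancel, vcount, List.countP_map]
      apply List.countP_mono_left
      intro S hS hv
      have h1 := h.1 S hS
      replace hv := of_decide_eq_true hv
      refine decide_eq_true ?_
      simp only [rviews, ivOverlap, ivLt] at h1 hv hA
      simp only
      omega
    · have : vcount α R (A :: L) = vcount α R L := by simp [vcount, hA]
      rw [this]
      refine ih.trans ?_
      apply List.Sublist.countP_le
      exact (List.tail_sublist L).map _

theorem gap_mono (L : List Rect) (α : Fin 2) (h : MonoL α L) :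
    ∃ K : List ℕ, K.length = L.length - 1 ∧ ∀ R : Rect,
      vcount α R L - 1 ≤ K.countP (fun x => decide ((rproj α R).1 < x ∧ x ≤ (rproj α R).2)) := by
  rcases h with h | h
  · exact gap_inc L α h
  · have := gap_inc L.reverse α (List.pairwise_reverse.2 h)
    simpa [vcount] using this

/-- hull of consecutive rectangles -/
def hull (L : List Rect) (i : ℕ) : Rect := bbox (L.getD i default) (L.getD (i+1) default)

theorem card_le_two (A : Finset ℕ) (h : ∀ i ∈ A, ∀ j ∈ A, ¬ (i + 2 ≤ j)) : A.card ≤ 2 := by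
  rcases A.eq_empty_or_nonempty with rfl | hne
  · simp
  · have : A ⊆ {A.min' hne, A.min' hne + 1} := by
      intro j hj
      have h1 := A.min'_le j hj
      have h2 := h _ (A.min'_mem hne) j hj
      simp only [Finset.mem_insert, Finset.mem_singleton]; omega
    exact (Finset.card_le_card this).trans Finset.card_le_two

theorem hull_two (L : List Rect) (α : Fin 2) (hv : ∀ R ∈ L, RValid R) (h : MonoL α L) (x : ℕ) :
    ((Finset.range (L.length - 1)).filter
      (fun i => (rproj α (hull L i)).1 < x ∧ x ≤ (rproj α (hull L i)).2)).card ≤ 2 := by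
  apply card_le_two
  intro i hi j hj hij
  simp only [Finset.mem_filter, Finset.mem_range, hull, rproj_bbox] at hi hj
  obtain ⟨hi0, hi⟩ := hi
  obtain ⟨hj0, hj⟩ := hj
  have e : ∀ k, (hk : k < L.length) → L.getD k default = L[k] := fun k hk => by
    simp [hk]
  rw [e i (by omega), e (i+1) (by omega)] at hi
  rw [e j (by omega), e (j+1) (by omega)] at hj
  have v0 := hv L[i] (List.getElem_mem _) α
  have v1 := hv L[i+1] (List.getElem_mem _) α
  have v2 := hv L[j] (List.getElem_mem _) α
  have v3 := hv L[j+1] (List.getElem_mem _) α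
  rcases h with h | h <;> rw [List.pairwise_iff_getElem] at h <;>
  · have h1 := h i (i+1) (by omega) (by omega) (by omega)
    have h2 := h (i+1) j (by omega) (by omega) (by omega)
    have h3 := h j (j+1) (by omega) (by omega) (by omega)
    simp only [ivLt] at h1 h2 h3
    omega

theorem hull_sum (L T : List Rect) (α : Fin 2) (hv : ∀ R ∈ L, RValid R) (h : MonoL α L)
    (hT : MonoL α T) :
    ∑ i ∈ Finset.range (L.length - 1), (vcount α (hull L i) T - 1) ≤ 2 * (T.length - 1) := by
  obtain ⟨K, hK, hb⟩ := gap_mono T α hT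
  refine (Finset.sum_le_sum (fun i _ => hb (hull L i))).trans ?_
  rw [← hK]
  clear hK hb
  induction K with
  | nil => simp
  | cons x K ih =>
    simp only [List.countP_cons, Finset.sum_add_distrib, decide_eq_true_eq, List.length_cons]
    have := hull_two L α hv h x
    rw [Finset.card_filter] at this
    omega

/-- excess -/
def excess (t : ℕ) (ℓ : ℕ → List Rect) (α : Fin 2) (c : ℕ) (R : Rect) : ℕ :=
  ∑ c' ∈ (Finset.range t).erase c, (vcount α R (ℓ c') - 1)

structure RInv (t : ℕ) (ℓ : ℕ → List Rect) : Prop where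
  valid : ∀ c, ∀ R ∈ ℓ c, RValid R
  mono : ∀ c α, MonoL α (ℓ c)
  exc : ∀ c < t, ∀ R ∈ ℓ c, ∀ α, excess t ℓ α c R ≤ 4 * (t - 1)

/-- the family -/
def fam (t : ℕ) (ℓ : ℕ → List Rect) : Fam := ∑ c ∈ Finset.range t, (ℓ c : Multiset Rect)

theorem exists_hull (t : ℕ) (ℓ : ℕ → List Rect) (h : RInv t ℓ)
    (hN : 0 < ∑ c ∈ Finset.range t, ((ℓ c).length - 1)) :
    ∃ c < t, ∃ i, i + 1 < (ℓ c).length ∧ ∀ α, excess t ℓ α c (hull (ℓ c) i) ≤ 4 * (t - 1) := by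
  by_contra hcon
  push Not at hcon
  have key : ∑ c ∈ Finset.range t, ∑ i ∈ Finset.range ((ℓ c).length - 1),
      (excess t ℓ 0 c (hull (ℓ c) i) + excess t ℓ 1 c (hull (ℓ c) i)) ≤
      4 * (t - 1) * ∑ c ∈ Finset.range t, ((ℓ c).length - 1) := by
    have one : ∀ α, ∑ c ∈ Finset.range t, ∑ i ∈ Finset.range ((ℓ c).length - 1),
      excess t ℓ α c (hull (ℓ c) i) ≤
      2 * (t - 1) * ∑ c ∈ Finset.range t, ((ℓ c).length - 1) := by
      intro α
      calc _ ≤ ∑ c ∈ Finset.range t, ∑ c' ∈ (Finset.range t).erase c,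
            2 * ((ℓ c').length - 1) := by
            apply Finset.sum_le_sum
            intro c _
            unfold excess
            rw [Finset.sum_comm]
            apply Finset.sum_le_sum
            intro c' _
            exact hull_sum _ _ α (h.valid c) (h.mono c α) (h.mono c' α)
        _ = ∑ c' ∈ Finset.range t, ∑ c ∈ (Finset.range t).erase c',
            2 * ((ℓ c').length - 1) := by
            apply Finset.sum_comm'
            intro x y
            simp only [Finset.mem_erase, Finset.mem_range]
            tauto
        _ = _ := by
            rw [Finset.mul_sum]
            apply Finset.sum_congr rfl
            intro c' hc'
            rw [Finset.sum_const, Finset.card_erase_of_mem hc', Finset.card_range, smul_eq_mul]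
            ring
    simp only [Finset.sum_add_distrib]
    have h0 := one 0
    have h1 := one 1
    calc _ ≤ _ := add_le_add h0 h1
      _ = _ := by ring
  have low : (4 * (t - 1) + 1) * ∑ c ∈ Finset.range t, ((ℓ c).length - 1) ≤
      ∑ c ∈ Finset.range t, ∑ i ∈ Finset.range ((ℓ c).length - 1),
      (excess t ℓ 0 c (hull (ℓ c) i) + excess t ℓ 1 c (hull (ℓ c) i)) := by
    rw [Finset.mul_sum]
    apply Finset.sum_le_sum
    intro c hc
    have : (4 * (t - 1) + 1) * ((ℓ c).length - 1) =
      ∑ i ∈ Finset.range ((ℓ c).length - 1), (4 * (t - 1) + 1) := by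
      rw [Finset.sum_const, Finset.card_range, smul_eq_mul, mul_comm]
    rw [this]
    apply Finset.sum_le_sum
    intro i hi
    rw [Finset.mem_range] at hi hc
    obtain ⟨α, hα⟩ := hcon c hc i (by omega)
    fin_cases α
    · simp at hα; omega
    · simp at hα; omega
  have := low.trans key
  rw [add_mul, one_mul] at this
  omega

theorem count_own (α : Fin 2) (L : List Rect) (h : MonoL α L) (R : Rect) (hR : R ∈ L) :
    vcount α R L ≤ 1 := by
  obtain ⟨u, w, rfl⟩ := List.append_of_mem hR
  have key : (∀ S ∈ u, ¬ rviews α R S) ∧ (∀ S ∈ w, ¬ rviews α R S) := by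
    rcases h with h | h <;> rw [List.pairwise_append, List.pairwise_cons] at h <;>
    · refine ⟨fun S hS hv => ?_, fun S hS hv => ?_⟩
      · have := h.2.2 S hS R (by simp)
        simp only [rviews, ivOverlap, ivLt] at *; omega
      · have := h.2.1.1 S hS
        simp only [rviews, ivOverlap, ivLt] at *; omega
  have hu : u.countP (fun S => decide (rviews α R S)) = 0 := by
    rw [List.countP_eq_zero]; simpa using key.1
  have hw : w.countP (fun S => decide (rviews α R S)) = 0 := by
    rw [List.countP_eq_zero]; simpa using key.2
  rw [vcount, List.countP_append, List.countP_cons, hu, hw]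
  split <;> simp

theorem rviews_self {R : Rect} (h : RValid R) (α : Fin 2) : rviews α R R := ⟨h α, h α⟩

theorem card_filter_fam (t : ℕ) (ℓ : ℕ → List Rect) (α : Fin 2) (R : Rect) :
    Multiset.card (Multiset.filter (fun R' => rviews α R R') (fam t ℓ)) =
      ∑ c ∈ Finset.range t, vcount α R (ℓ c) := by
  unfold fam
  induction t with
  | zero => simp
  | succ t ih =>
    rw [Finset.sum_range_succ, Finset.sum_range_succ, Multiset.filter_add, Multiset.card_add, ih]
    simp [vcount, List.countP_eq_length_filter]

theorem mem_fam {t : ℕ} {ℓ : ℕ → List Rect} {R : Rect} :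
    R ∈ fam t ℓ ↔ ∃ c < t, R ∈ ℓ c := by
  simp [fam, Multiset.mem_sum]

theorem wide_of_inv (t : ℕ) (ℓ : ℕ → List Rect) (h : RInv t ℓ) : Wide (6 * t - 5) (fam t ℓ) := by
  intro R hR α
  obtain ⟨c, hc, hRc⟩ := mem_fam.1 hR
  have h1 := card_filter_fam t ℓ α R
  rw [← Multiset.cons_erase hR, Multiset.filter_cons_of_pos _ (rviews_self (h.valid c R hRc) α),
    Multiset.card_cons] at h1
  rw [← Finset.add_sum_erase _ _ (Finset.mem_range.2 hc)] at h1
  have h2 := count_own α _ (h.mono c α) R hRc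
  have h3 := h.exc c hc R hRc α
  have h4 : ∑ c' ∈ (Finset.range t).erase c, vcount α R (ℓ c') ≤ excess t ℓ α c R + (t - 1) := by
    have : t - 1 = ∑ c' ∈ (Finset.range t).erase c, 1 := by
      rw [Finset.sum_const, Finset.card_erase_of_mem (Finset.mem_range.2 hc)]; simp
    rw [this, excess, ← Finset.sum_add_distrib]
    apply Finset.sum_le_sum
    intro i _
    omega
  have h6 : ∀ n, n + 1 = vcount α R (ℓ c) +
      ∑ c' ∈ (Finset.range t).erase c, vcount α R (ℓ c') → n < 6 * t - 5 := by
    intro n hn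
    omega
  exact h6 _ h1

theorem mono_merge (α : Fin 2) (u w : List Rect) (R S : Rect)
    (h : MonoL α (u ++ R :: S :: w)) : MonoL α (u ++ bbox R S :: w) := by
  rcases h with h | h <;> rw [List.pairwise_append, List.pairwise_cons, List.pairwise_cons] at h
  · left
    rw [List.pairwise_append, List.pairwise_cons]
    refine ⟨h.1, ⟨fun A hA => ?_, h.2.1.2.2⟩, fun A hA B hB => ?_⟩
    · have h1 := h.2.1.1 A (by simp [hA])
      have h2 := h.2.1.2.1 A hA
      simp only [ivLt, rproj_bbox] at *; omega
    · rcases List.mem_cons.1 hB with rfl | hB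
      · have h1 := h.2.2 A hA R (by simp)
        have h2 := h.2.2 A hA S (by simp)
        simp only [ivLt, rproj_bbox] at *; omega
      · exact h.2.2 A hA B (by simp [hB])
  · right
    rw [List.pairwise_append, List.pairwise_cons]
    refine ⟨h.1, ⟨fun A hA => ?_, h.2.1.2.2⟩, fun A hA B hB => ?_⟩
    · have h1 := h.2.1.1 A (by simp [hA])
      have h2 := h.2.1.2.1 A hA
      simp only [ivLt, rproj_bbox] at *; omega
    · rcases List.mem_cons.1 hB with rfl | hB
      · have h1 := h.2.2 A hA R (by simp)
        have h2 := h.2.2 A hA S (by simp)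
        simp only [ivLt, rproj_bbox] at *; omega
      · exact h.2.2 A hA B (by simp [hB])

theorem count_merge (α : Fin 2) (u w : List Rect) (R S Q : Rect) (hR : RValid R) (hS : RValid S)
    (h : MonoL α (u ++ R :: S :: w)) :
    vcount α Q (u ++ bbox R S :: w) - 1 ≤ vcount α Q (u ++ R :: S :: w) - 1 := by
  by_cases hv : rviews α Q R ∨ rviews α Q S
  · simp only [vcount, List.countP_append, List.countP_cons, decide_eq_true_eq]
    rcases hv with hv | hv
    · rw [if_pos hv]; split <;> omega
    · rw [if_pos hv]; split <;> omega
  · by_cases hb : rviews α Q (bbox R S)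
    · have key : (∀ A ∈ u, ¬ rviews α Q A) ∧ (∀ A ∈ w, ¬ rviews α Q A) := by
        have vR := hR α
        have vS := hS α
        rcases h with h | h <;>
          rw [List.pairwise_append, List.pairwise_cons, List.pairwise_cons] at h <;>
        · have h0 := h.2.1.1 S (by simp)
          refine ⟨fun A hA hv => ?_, fun A hA hv => ?_⟩
          · have h1 := h.2.2 A hA R (by simp)
            have h2 := h.2.2 A hA S (by simp)
            simp only [rviews, ivOverlap, ivLt, rproj_bbox] at *; omega
          · have h1 := h.2.1.1 A (by simp [hA])
            have h2 := h.2.1.2.1 A hA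
            simp only [rviews, ivOverlap, ivLt, rproj_bbox] at *; omega
      have hu : u.countP (fun S => decide (rviews α Q S)) = 0 := by
        rw [List.countP_eq_zero]; simpa using key.1
      have hw : w.countP (fun S => decide (rviews α Q S)) = 0 := by
        rw [List.countP_eq_zero]; simpa using key.2
      simp [vcount, List.countP_append, List.countP_cons, hu, hw, hb]
    · simp only [vcount, List.countP_append, List.countP_cons, decide_eq_true_eq]
      rw [if_neg hb]; omega

theorem split_at (L : List Rect) (i : ℕ) (hi : i + 1 < L.length) :
    ∃ u R S w, L = u ++ R :: S :: w ∧ hull L i = bbox R S := by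
  refine ⟨L.take i, L[i], L[i+1], L.drop (i+2), ?_, ?_⟩
  · rw [List.getElem_cons_drop, List.getElem_cons_drop, List.take_append_drop]
  · have : i < L.length := by omega
    simp [hull, hi, this]

theorem step (t : ℕ) (ℓ : ℕ → List Rect) (h : RInv t ℓ)
    (hN : 0 < ∑ c ∈ Finset.range t, ((ℓ c).length - 1)) :
    ∃ ℓ', RInv t ℓ' ∧ MergeStep (fam t ℓ) (fam t ℓ') := by
  obtain ⟨c, hc, i, hi, hex⟩ := exists_hull t ℓ h hN
  obtain ⟨u, R, S, w, hL, hH⟩ := split_at _ i hi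
  rw [hH] at hex
  have hRv : RValid R := h.valid c R (by simp [hL])
  have hSv : RValid S := h.valid c S (by simp [hL])
  set ℓ' := Function.update ℓ c (u ++ bbox R S :: w) with hℓ'
  have e1 : ℓ' c = u ++ bbox R S :: w := by simp [hℓ']
  have e2 : ∀ c' ≠ c, ℓ' c' = ℓ c' := fun c' hc' => by simp [hℓ', hc']
  have hcnt : ∀ α Q c', vcount α Q (ℓ' c') - 1 ≤ vcount α Q (ℓ c') - 1 := by
    intro α Q c'
    by_cases hcc : c' = c
    · subst hcc
      rw [e1, hL]
      exact count_merge α u w R S Q hRv hSv (hL ▸ h.mono c' α)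
    · rw [e2 c' hcc]
  have hexc : ∀ α c' Q, excess t ℓ' α c' Q ≤ excess t ℓ α c' Q := fun α c' Q =>
    Finset.sum_le_sum (fun d _ => hcnt α Q d)
  have hmem : ∀ c', ∀ Q ∈ ℓ' c', Q ∈ ℓ c' ∨ (c' = c ∧ Q = bbox R S) := by
    intro c' Q hQ
    by_cases hcc : c' = c
    · subst hcc
      rw [e1] at hQ
      rw [hL]
      simp only [List.mem_append, List.mem_cons] at hQ ⊢
      tauto
    · rw [e2 c' hcc] at hQ; exact Or.inl hQ
  refine ⟨ℓ', ⟨?_, ?_, ?_⟩, ?_⟩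
  · intro c' Q hQ
    rcases hmem c' Q hQ with hQ | ⟨_, rfl⟩
    · exact h.valid c' Q hQ
    · exact rvalid_bbox hRv
  · intro c' α
    by_cases hcc : c' = c
    · subst hcc; rw [e1]; exact mono_merge α u w R S (hL ▸ h.mono c' α)
    · rw [e2 c' hcc]; exact h.mono c' α
  · intro c' hc' Q hQ α
    refine (hexc α c' Q).trans ?_
    rcases hmem c' Q hQ with hQ | ⟨rfl, rfl⟩
    · exact h.exc c' hc' Q hQ α
    · exact hex α
  · set Z : Multiset Rect := (u : Multiset Rect) + (w : Multiset Rect) +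
      ∑ c' ∈ (Finset.range t).erase c, (ℓ c' : Multiset Rect) with hZ
    have f1 : fam t ℓ = R ::ₘ S ::ₘ Z := by
      unfold fam
      rw [← Finset.add_sum_erase _ _ (Finset.mem_range.2 hc), hL, ← Multiset.coe_add,
        ← Multiset.cons_coe, ← Multiset.cons_coe, hZ]
      simp only [Multiset.add_cons, Multiset.cons_add, add_assoc]
    have f2 : fam t ℓ' = bbox R S ::ₘ Z := by
      unfold fam
      rw [← Finset.add_sum_erase _ _ (Finset.mem_range.2 hc), e1, ← Multiset.coe_add,
        ← Multiset.cons_coe, hZ]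
      rw [Finset.sum_congr rfl (fun c' hc' => by rw [e2 c' (Finset.ne_of_mem_erase hc')])]
      simp only [Multiset.add_cons, Multiset.cons_add, add_assoc]
    rw [f1, f2]
    exact ⟨R, S, by simp, by simp, by simp⟩

/-- good family -/
def Good (d : ℕ) (F : Fam) : Prop :=
  ∃ L : List Fam, L.head? = some F ∧ List.IsChain MergeStep L ∧
    (∃ F', L.getLast? = some F' ∧ Multiset.card F' = 1) ∧ ∀ F' ∈ L, Wide d F'

theorem good_one (d : ℕ) (F : Fam) (h : Multiset.card F = 1) (hw : Wide d F) : Good d F :=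
  ⟨[F], by simp, by simp, ⟨F, by simp, h⟩, by simpa using hw⟩

theorem good_step (d : ℕ) (F F' : Fam) (hw : Wide d F) (hm : MergeStep F F') (h : Good d F') :
    Good d F := by
  obtain ⟨L, h1, h2, ⟨G, h3, h4⟩, h5⟩ := h
  cases L with
  | nil => simp at h1
  | cons A L =>
    simp only [List.head?_cons, Option.some.injEq] at h1
    subst h1
    refine ⟨F :: A :: L, by simp, ?_, ⟨G, ?_, h4⟩, ?_⟩
    · exact List.isChain_cons_cons.2 ⟨hm, h2⟩
    · rw [List.getLast?_cons_cons]; exact h3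
    · intro X hX
      rcases List.mem_cons.1 hX with rfl | hX
      · exact hw
      · exact h5 X hX

theorem good_small (d n : ℕ) : ∀ F : Fam, Multiset.card F = n + 1 → n < d → Good d F := by
  induction n with
  | zero =>
    intro F hF hd
    refine good_one d F hF (fun R hR α => ?_)
    refine (Multiset.card_le_card (Multiset.filter_le _ _)).trans_lt ?_
    rw [Multiset.card_erase_of_mem hR, hF]; simpa using hd
  | succ n ih =>
    intro F hF hd
    obtain ⟨R, hR⟩ := Multiset.card_pos_iff_exists_mem.1 (by omega : 0 < Multiset.card F)
    obtain ⟨G, rfl⟩ := Multiset.exists_cons_of_mem hR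
    have hG : Multiset.card G = n + 1 := by simpa using hF
    obtain ⟨S, hS⟩ := Multiset.card_pos_iff_exists_mem.1 (by omega : 0 < Multiset.card G)
    obtain ⟨Z, rfl⟩ := Multiset.exists_cons_of_mem hS
    refine good_step d _ (bbox R S ::ₘ Z) (fun Q hQ α => ?_) ⟨R, S, by simp, by simp, by simp⟩ 
      (ih _ (by simpa using hG) (by omega))
    refine (Multiset.card_le_card (Multiset.filter_le _ _)).trans_lt ?_
    rw [Multiset.card_erase_of_mem hQ, hF]; simpa using hd

theorem good_inv (t n : ℕ) : ∀ ℓ, RInv t ℓ → Multiset.card (fam t ℓ) = n + 1 →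
    Good (6 * t - 5) (fam t ℓ) := by
  induction n with
  | zero => intro ℓ h hn; exact good_one _ _ hn (wide_of_inv t ℓ h)
  | succ n ih =>
    intro ℓ h hn
    by_cases hN : 0 < ∑ c ∈ Finset.range t, ((ℓ c).length - 1)
    · obtain ⟨ℓ', h', hm⟩ := step t ℓ h hN
      refine good_step _ _ _ (wide_of_inv t ℓ h) hm (ih ℓ' h' ?_)
      obtain ⟨R, S, hR, hS, he⟩ := hm
      rw [he, Multiset.card_cons, Multiset.card_erase_of_mem hS, Multiset.card_erase_of_mem hR, hn]
      simp
    · refine good_small _ _ _ hn ?_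
      have h1 : Multiset.card (fam t ℓ) = ∑ c ∈ Finset.range t, (ℓ c).length := by
        simp [fam]
      have h2 : ∑ c ∈ Finset.range t, (ℓ c).length ≤
          ∑ c ∈ Finset.range t, ((ℓ c).length - 1) + t := by
        have : t = ∑ c ∈ Finset.range t, 1 := by simp
        conv_rhs => rw [this]
        simp only [Finset.sum_const, Finset.card_range, smul_eq_mul, mul_one]
        calc _ ≤ ∑ c ∈ Finset.range t, (((ℓ c).length - 1) + 1) :=
              Finset.sum_le_sum (fun i _ => by omega)
          _ = _ := by rw [Finset.sum_add_distrib]; simp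
      omega

theorem sum_filter_fibers (t : ℕ) (f : Pt → ℕ) (M : Multiset Pt) (h : ∀ p ∈ M, f p < t) :
    ∑ c ∈ Finset.range t, M.filter (fun p => f p = c) = M := by
  induction M using Multiset.induction with
  | empty => simp
  | cons a M ih =>
    have ha := h a (by simp)
    simp only [Multiset.filter_cons, Finset.sum_add_distrib]
    rw [ih (fun p hp => h p (by simp [hp])), Finset.sum_ite_eq]
    simp [ha]

theorem sorted_list (P : Finset Pt) (hP : GenPos P) :
    ∃ L : List Pt, (L : Multiset Pt) = P.val ∧ L.Pairwise (fun a b => a.1 < b.1) := by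
  let r : Pt → Pt → Prop := fun a b => a.1 ≤ b.1
  have : Std.Total r := ⟨fun a b => le_total a.1 b.1⟩
  have : IsTrans Pt r := ⟨fun a b c hab hbc => le_trans (show a.1 ≤ b.1 from hab) hbc⟩
  have hperm := List.perm_insertionSort r P.toList
  refine ⟨P.toList.insertionSort r, ?_, ?_⟩
  · rw [Multiset.coe_eq_coe.2 hperm]; exact Finset.coe_toList P
  · have h1 := List.pairwise_insertionSort r P.toList
    have h2 : (P.toList.insertionSort r).Nodup := hperm.nodup_iff.2 P.nodup_toList
    refine (h1.and h2).imp_of_mem ?_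
    intro a b ha hb hab
    have ha' := Finset.mem_toList.1 (hperm.mem_iff.1 ha)
    have hb' := Finset.mem_toList.1 (hperm.mem_iff.1 hb)
    exact lt_of_le_of_ne hab.1 (hP a ha' b hb' hab.2).1

theorem start_inv (t : ℕ) (P : Finset Pt) (hP : GenPos P) (h : TMonotone t P) :
    ∃ ℓ, RInv t ℓ ∧ fam t ℓ = Multiset.map ptRect P.val := by
  obtain ⟨f, hf, hm⟩ := h
  have hs : ∀ c, ∃ L : List Pt, (L : Multiset Pt) = (P.filter (fun p => f p = c)).val ∧
      L.Pairwise (fun a b => a.1 < b.1) := fun c => sorted_list _ (fun p hp q hq =>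
        hP p (Finset.mem_filter.1 hp).1 q (Finset.mem_filter.1 hq).1)
  choose L hL hpw using hs
  have hmem : ∀ c, ∀ p ∈ L c, p ∈ P ∧ f p = c := by
    intro c p hp
    rw [← Multiset.mem_coe, hL] at hp
    simpa using hp
  refine ⟨fun c => (L c).map ptRect, ⟨?_, ?_, ?_⟩, ?_⟩
  · intro c R hR
    obtain ⟨p, _, rfl⟩ := List.mem_map.1 hR
    intro α
    unfold rproj ptRect; split <;> simp
  · intro c α
    have hα : α = 0 ∨ α = 1 := by fin_cases α <;> simp
    unfold MonoL
    rw [List.pairwise_map, List.pairwise_map]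
    rcases hα with rfl | rfl
    · left
      simpa [ivLt, rproj, ptRect] using hpw c
    · rcases hm c with hc | hc
      · left
        refine (hpw c).imp_of_mem (fun {a b} ha hb hab => ?_)
        simpa [ivLt, rproj, ptRect] using (hc a (hmem c a ha) b (hmem c b hb)).1 hab
      · right
        refine (hpw c).imp_of_mem (fun {a b} ha hb hab => ?_)
        simpa [ivLt, rproj, ptRect] using (hc a (hmem c a ha) b (hmem c b hb)).1 hab
  · intro c hc R hR α
    have : excess t (fun c => (L c).map ptRect) α c R = 0 := by
      unfold excess
      apply Finset.sum_eq_zero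
      intro c' hc'
      have hne := Finset.ne_of_mem_erase hc'
      obtain ⟨p, hp, rfl⟩ := List.mem_map.1 hR
      have : vcount α (ptRect p) ((L c').map ptRect) = 0 := by
        unfold vcount
        rw [List.countP_eq_zero]
        intro S hS
        obtain ⟨q, hq, rfl⟩ := List.mem_map.1 hS
        have hp' := hmem c p hp
        have hq' := hmem c' q hq
        have hpq : p ≠ q := by
          rintro rfl
          exact hne (hq'.2.symm.trans hp'.2)
        have := hP p hp'.1 q hq'.1 hpq
        intro hv
        replace hv := of_decide_eq_true hv
        simp only [rviews, ivOverlap, rproj, ptRect] at hv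
        split at hv <;> simp only at hv <;> omega
      simp [this]
    omega
  · unfold fam
    conv_rhs => rw [← sum_filter_fibers t f P.val hf]
    rw [← Multiset.coe_mapAddMonoidHom, map_sum]
    apply Finset.sum_congr rfl
    intro c _
    rw [Multiset.coe_mapAddMonoidHom, ← Multiset.map_coe, hL, Finset.filter_val]

/-- every t-monotone permutation has width at most 6t−5. -/
theorem stmt11 (t : ℕ) (P : Finset Pt) (hP : GenPos P) (h : TMonotone t P) :
    permWidth P ≤ 6 * t - 5 := by
  rcases P.eq_empty_or_nonempty with rfl | hne
  · have : {d | HasWidthLE (∅ : Finset Pt) d} = ∅ := by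
      ext d
      simp only [Set.mem_ofPred_eq, Set.mem_empty_iff_false, iff_false]
      rintro ⟨L, ⟨h1, h2, F, h3, h4⟩, -⟩
      cases L with
      | nil => simp at h1
      | cons A L =>
        simp only [List.head?_cons, Option.some.injEq] at h1
        cases L with
        | nil =>
          simp only [List.getLast?_singleton, Option.some.injEq] at h3
          subst h3
          rw [h1] at h4
          simp at h4
        | cons B L =>
          obtain ⟨R1, R2, hR, -⟩ := (List.isChain_cons_cons.1 h2).1
          rw [h1] at hR
          simp at hR
    rw [permWidth, this, Nat.sInf_empty]
    exact Nat.zero_le _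
  · apply Nat.sInf_le
    obtain ⟨ℓ, hI, hF⟩ := start_inv t P hP h
    have hpos := hne.card_pos
    have hg := good_inv t (P.card - 1) ℓ hI (by
      rw [hF, Multiset.card_map, Finset.card_val]; omega)
    rw [hF] at hg
    obtain ⟨L, h1, h2, h3, h4⟩ := hg
    exact ⟨L, ⟨h1, h2, h3⟩, h4⟩
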